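/- Let ε, μ : ℝ³ → ℝ be C² up to the boundary of Π with ε > 0 and μ > 0 on the closure of Π. Let v, f : ℝ³ → ℂ³ be C¹ up to the boundary, with v of compact axial support and div(μv) = 0 on Π. Then ∫_Π ε⁻¹·⟨curl v, curl f⟩ dx = ∫_Π ⟨curl(μv), curl((εμ)⁻¹f)⟩ dx − ∫_Π ⟨curl v, μ·[∇((εμ)⁻¹), f]⟩ dx + ∫_Π ε⁻¹·⟨W₀(μ)v, f⟩ dx + ∫_Π (εμ)⁻¹ Σⱼ (∂ⱼμ)·⟨∂ⱼv, f⟩ dx + ∫_{∂Π} (εμ)⁻¹·⟨[∇μ, v], [f, ν]⟩ dS. -/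

import Mathlib

noncomputable section

open MeasureTheory Real Complex

/-- Points of `ℝ³`. -/
abbrev V3 := Fin 3 → ℝ
/-- Vectors of `ℂ³`. -/
abbrev C3 := Fin 3 → ℂ

/-- Partial derivative `∂ⱼ` of a complex scalar function on `ℝ³`. -/
def pd (j : Fin 3) (f : V3 → ℂ) (x : V3) : ℂ := fderiv ℝ f x (Pi.single j 1)

/-- Partial derivative `∂ⱼ` of a real scalar function on `ℝ³`. -/
def pdR (j : Fin 3) (f : V3 → ℝ) (x : V3) : ℝ := fderiv ℝ f x (Pi.single j 1)

/-- Partial derivative `∂ⱼ` of a vector field, taken componentwise. -/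
def pdV (j : Fin 3) (a : V3 → C3) (x : V3) : C3 := fun i => pd j (fun y => a y i) x

/-- curl a = (∂₂a₃ − ∂₃a₂, ∂₃a₁ − ∂₁a₃, ∂₁a₂ − ∂₂a₁)  (indices 0,1,2). -/
def vcurl (a : V3 → C3) (x : V3) : C3 :=
  ![pd 1 (fun y => a y 2) x - pd 2 (fun y => a y 1) x,
    pd 2 (fun y => a y 0) x - pd 0 (fun y => a y 2) x,
    pd 0 (fun y => a y 1) x - pd 1 (fun y => a y 0) x]

/-- div a = ∂₁a₁ + ∂₂a₂ + ∂₃a₃. -/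
def vdiv (a : V3 → C3) (x : V3) : ℂ := ∑ j, pd j (fun y => a y j) x

/-- The bilinear (unconjugated) cross product on ℂ³. -/
def cross (a b : C3) : C3 :=
  ![a 1 * b 2 - a 2 * b 1, a 2 * b 0 - a 0 * b 2, a 0 * b 1 - a 1 * b 0]

/-- The Hermitian inner product ⟨a, b⟩ = Σⱼ aⱼ · conj(bⱼ). -/
def hinner (a b : C3) : ℂ := ∑ j, a j * (starRingEnd ℂ) (b j)

/-- The gradient of a real function, viewed as a complex vector. -/
def gradC (g : V3 → ℝ) (x : V3) : C3 := fun j => (pdR j g x : ℂ)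

/-- The Laplacian Δg = ∂₁²g + ∂₂²g + ∂₃²g of a real function. -/
def lapR (g : V3 → ℝ) (x : V3) : ℝ := ∑ j, pdR j (fun y => pdR j g y) x

/-- The solid infinite circular cylinder Π of radius `R`. -/
def Cyl (R : ℝ) : Set V3 := {x | x 0 ^ 2 + x 1 ^ 2 < R ^ 2}

/-- The boundary ∂Π of the cylinder. -/
def bCyl (R : ℝ) : Set V3 := {x | x 0 ^ 2 + x 1 ^ 2 = R ^ 2}

/-- The outward unit normal of the cylinder at a boundary point. -/
def nuR (R : ℝ) (x : V3) : V3 := ![x 0 / R, x 1 / R, 0]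

/-- The outward unit normal, viewed as a complex vector. -/
def nuC (R : ℝ) (x : V3) : C3 := fun j => (nuR R x j : ℂ)

/-- The normal component ⟨z, ν⟩ of z ∈ ℂ³ at a boundary point of the cylinder. -/
def ncomp (R : ℝ) (x : V3) (z : C3) : ℂ := ∑ k, z k * (nuR R x k : ℂ)

/-- The normal derivative ∂_ν g = ⟨∇g, ν⟩ of a real function at a boundary point. -/
def dnu (R : ℝ) (g : V3 → ℝ) (x : V3) : ℝ := ∑ k, pdR k g x * nuR R x k

/-- The surface integral ∫_{∂Π} F dS = ∫_ℝ ∫₀^{2π} F(R cos θ, R sin θ, t)·R dθ dt. -/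
def surfInt (R : ℝ) (F : V3 → ℂ) : ℂ :=
  ∫ t : ℝ, ∫ θ in (0:ℝ)..(2 * π), F ![R * Real.cos θ, R * Real.sin θ, t] * (R : ℂ)

/-- `f` is `C^k` up to the boundary of the open set `S`: it is `k` times continuously
differentiable on an open neighborhood of the closure of `S`. -/
def UpTo {E : Type*} [NormedAddCommGroup E] [NormedSpace ℝ E]
    (k : ℕ) (S : Set V3) (f : V3 → E) : Prop :=
  ∃ U : Set V3, IsOpen U ∧ closure S ⊆ U ∧ ContDiffOn ℝ k f U

/-- `f` has compact axial support: it vanishes whenever `|x₃| ≥ T` for some `T > 0`. -/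
def AxialSupp {E : Type*} [Zero E] (f : V3 → E) : Prop :=
  ∃ T > 0, ∀ x : V3, T ≤ |x 2| → f x = 0

/-- The matrix W₀(μ)ⱼₖ = μ⁻¹(Δμ)δⱼₖ + μ⁻²(∂ⱼμ)(∂ₖμ) − μ⁻¹∂ⱼ∂ₖμ. -/
def W0 (μ : V3 → ℝ) (x : V3) (j k : Fin 3) : ℝ :=
  (μ x)⁻¹ * lapR μ x * (if j = k then 1 else 0)
    + ((μ x) ^ 2)⁻¹ * pdR j μ x * pdR k μ x
    - (μ x)⁻¹ * pdR j (fun y => pdR k μ y) x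

/-- The matrix W(μ)ⱼₖ = ((2μ)⁻¹Δμ − (4μ²)⁻¹|∇μ|²)δⱼₖ + μ⁻²(∂ⱼμ)(∂ₖμ) − μ⁻¹∂ⱼ∂ₖμ. -/
def Wm (μ : V3 → ℝ) (x : V3) (j k : Fin 3) : ℝ :=
  ((2 * μ x)⁻¹ * lapR μ x - (4 * (μ x) ^ 2)⁻¹ * (∑ i, (pdR i μ x) ^ 2))
      * (if j = k then 1 else 0)
    + ((μ x) ^ 2)⁻¹ * pdR j μ x * pdR k μ x
    - (μ x)⁻¹ * pdR j (fun y => pdR k μ y) x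


theorem clm_prod_apply (L : ℝ × ℝ →L[ℝ] ℂ) (a b : ℝ) :
    L (a, b) = a * L (1, 0) + b * L (0, 1) := by
  have h : ((a, b) : ℝ × ℝ) = a • ((1, 0) : ℝ × ℝ) + b • ((0, 1) : ℝ × ℝ) := by simp
  rw [h, map_add, map_smul, map_smul, real_smul, real_smul]

theorem integral_neg_pi_pi_eq {g : ℝ → ℂ} (hg : Function.Periodic g (2 * π)) :
    ∫ θ in (-π)..π, g θ = ∫ θ in (0 : ℝ)..(2 * π), g θ := by
  have h := hg.intervalIntegral_add_eq (-π) 0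
  rwa [show -π + 2 * π = π by ring, zero_add] at h

/-- The divergence theorem on a disk. -/
theorem integral_divergence_disk {R : ℝ} (hR : 0 < R) {P Q : ℝ × ℝ → ℂ}
    (hP : ∀ p : ℝ × ℝ, p.1 ^ 2 + p.2 ^ 2 ≤ R ^ 2 → ContDiffAt ℝ 1 P p)
    (hQ : ∀ p : ℝ × ℝ, p.1 ^ 2 + p.2 ^ 2 ≤ R ^ 2 → ContDiffAt ℝ 1 Q p) :
    ∫ p in {p : ℝ × ℝ | p.1 ^ 2 + p.2 ^ 2 < R ^ 2},
        (fderiv ℝ P p (1, 0) + fderiv ℝ Q p (0, 1))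
      = ∫ θ in (0 : ℝ)..(2 * π), (P (R * Real.cos θ, R * Real.sin θ) * (Real.cos θ : ℂ)
          + Q (R * Real.cos θ, R * Real.sin θ) * (Real.sin θ : ℂ)) * (R : ℂ) := by
  set Φ : ℝ × ℝ → ℝ × ℝ := fun q => (q.1 * Real.cos q.2, q.1 * Real.sin q.2) with hΦ
  have hΦs : ContDiff ℝ 1 Φ := by fun_prop
  have hΦle : ∀ q : ℝ × ℝ, q.1 ∈ Set.Icc 0 R → (Φ q).1 ^ 2 + (Φ q).2 ^ 2 ≤ R ^ 2 := by
    intro q hq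
    have : (Φ q).1 ^ 2 + (Φ q).2 ^ 2 = q.1 ^ 2 := by
      simp only [hΦ]
      linear_combination q.1 ^ 2 * Real.sin_sq_add_cos_sq q.2
    rw [this]
    exact pow_le_pow_left₀ hq.1 hq.2 2
  set A : ℝ × ℝ → ℂ := fun q =>
    (q.1 : ℂ) * (P (Φ q) * (Real.cos q.2 : ℂ) + Q (Φ q) * (Real.sin q.2 : ℂ)) with hA
  set B : ℝ × ℝ → ℂ := fun q =>
    Q (Φ q) * (Real.cos q.2 : ℂ) - P (Φ q) * (Real.sin q.2 : ℂ) with hB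
  have hcos : ContDiff ℝ 1 (fun q : ℝ × ℝ => (Real.cos q.2 : ℂ)) :=
    ofRealCLM.contDiff.comp (Real.contDiff_cos.comp contDiff_snd)
  have hsin : ContDiff ℝ 1 (fun q : ℝ × ℝ => (Real.sin q.2 : ℂ)) :=
    ofRealCLM.contDiff.comp (Real.contDiff_sin.comp contDiff_snd)
  have hfst : ContDiff ℝ 1 (fun q : ℝ × ℝ => (q.1 : ℂ)) :=
    ofRealCLM.contDiff.comp contDiff_fst
  have hPΦ : ∀ q : ℝ × ℝ, q.1 ∈ Set.Icc 0 R → ContDiffAt ℝ 1 (fun q => P (Φ q)) q :=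
    fun q hq => (hP _ (hΦle q hq)).comp q hΦs.contDiffAt
  have hQΦ : ∀ q : ℝ × ℝ, q.1 ∈ Set.Icc 0 R → ContDiffAt ℝ 1 (fun q => Q (Φ q)) q :=
    fun q hq => (hQ _ (hΦle q hq)).comp q hΦs.contDiffAt
  have hAs : ∀ q : ℝ × ℝ, q.1 ∈ Set.Icc 0 R → ContDiffAt ℝ 1 A q := fun q hq =>
    hfst.contDiffAt.mul (((hPΦ q hq).mul hcos.contDiffAt).add ((hQΦ q hq).mul hsin.contDiffAt))
  have hBs : ∀ q : ℝ × ℝ, q.1 ∈ Set.Icc 0 R → ContDiffAt ℝ 1 B q := fun q hq =>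
    ((hQΦ q hq).mul hcos.contDiffAt).sub ((hPΦ q hq).mul hsin.contDiffAt)
  have key : ∀ q : ℝ × ℝ, q.1 ∈ Set.Icc 0 R → fderiv ℝ A q (1, 0) + fderiv ℝ B q (0, 1)
      = q.1 • (fderiv ℝ P (Φ q) (1, 0) + fderiv ℝ Q (Φ q) (0, 1)) := by
    rintro ⟨r, θ⟩ hq
    have hP' := ((hP _ (hΦle _ hq)).differentiableAt one_ne_zero).hasFDerivAt
    have hQ' := ((hQ _ (hΦle _ hq)).differentiableAt one_ne_zero).hasFDerivAt
    have hA' := ((hAs _ hq).differentiableAt one_ne_zero).hasFDerivAt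
    have hB' := ((hBs _ hq).differentiableAt one_ne_zero).hasFDerivAt
    have lr : HasDerivAt (fun s : ℝ => (s, θ)) (1, 0) r :=
      (hasDerivAt_id r).prodMk (hasDerivAt_const r θ)
    have lθ : HasDerivAt (fun s : ℝ => (r, s)) (0, 1) θ :=
      (hasDerivAt_const θ r).prodMk (hasDerivAt_id θ)
    have Φr : HasDerivAt (fun s : ℝ => Φ (s, θ)) (Real.cos θ, Real.sin θ) r := by
      simpa using ((hasDerivAt_id r).mul_const (Real.cos θ)).prodMk
        ((hasDerivAt_id r).mul_const (Real.sin θ))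
    have Φθ : HasDerivAt (fun s : ℝ => Φ (r, s)) (r * -Real.sin θ, r * Real.cos θ) θ :=
      ((Real.hasDerivAt_cos θ).const_mul r).prodMk ((Real.hasDerivAt_sin θ).const_mul r)
    have Pr := hP'.comp_hasDerivAt r Φr
    have Qr := hQ'.comp_hasDerivAt r Φr
    have Pθ := hP'.comp_hasDerivAt θ Φθ
    have Qθ := hQ'.comp_hasDerivAt θ Φθ
    have lA := hA'.comp_hasDerivAt r lr
    have lB := hB'.comp_hasDerivAt θ lθ
    have mA : HasDerivAt (A ∘ fun s => (s, θ)) _ r := (hasDerivAt_id r).ofReal_comp.mul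
      ((Pr.mul_const (Real.cos θ : ℂ)).add (Qr.mul_const (Real.sin θ : ℂ)))
    have mB : HasDerivAt (B ∘ fun s => (r, s)) _ θ :=
      (Qθ.mul (Real.hasDerivAt_cos θ).ofReal_comp).sub
        (Pθ.mul (Real.hasDerivAt_sin θ).ofReal_comp)
    have eA := lA.unique mA
    have eB := lB.unique mB
    rw [eA, eB, clm_prod_apply _ (Real.cos θ), clm_prod_apply _ (Real.cos θ),
      clm_prod_apply _ (r * _), clm_prod_apply _ (r * _)]
    have hcs : (Real.sin θ : ℂ) ^ 2 + (Real.cos θ : ℂ) ^ 2 = 1 := by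
      exact_mod_cast Real.sin_sq_add_cos_sq θ
    simp only [Function.comp_apply, id, real_smul]
    push_cast at hcs ⊢
    linear_combination (r * (fderiv ℝ P (Φ (r, θ)) (1, 0) + fderiv ℝ Q (Φ (r, θ)) (0, 1))) * hcs
  have hle : ((0, -π) : ℝ × ℝ) ≤ (R, π) := ⟨hR.le, by linarith [pi_pos]⟩
  have hmem : ∀ q ∈ Set.Icc ((0, -π) : ℝ × ℝ) (R, π), q.1 ∈ Set.Icc 0 R :=
    fun q hq => ⟨hq.1.1, hq.2.1⟩
  have hmem' : ∀ q ∈ Set.Ioo (0 : ℝ) R ×ˢ Set.Ioo (-π) π, q.1 ∈ Set.Icc 0 R :=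
    fun q hq => ⟨hq.1.1.le, hq.1.2.le⟩
  have hint : IntegrableOn (fun q => fderiv ℝ A q (1, 0) + fderiv ℝ B q (0, 1))
      (Set.Icc ((0, -π) : ℝ × ℝ) (R, π)) := by
    refine ContinuousOn.integrableOn_compact isCompact_Icc fun q hq => ?_
    exact ((((hAs q (hmem q hq)).continuousAt_fderiv one_ne_zero).clm_apply
      continuousAt_const).add (((hBs q (hmem q hq)).continuousAt_fderiv one_ne_zero).clm_apply
      continuousAt_const)).continuousWithinAt
  have hdivergence := integral_divergence_prod_Icc_of_hasFDerivAt_off_countable_of_le A B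
    (fderiv ℝ A) (fderiv ℝ B) (0, -π) (R, π) hle ∅ Set.countable_empty
    (fun q hq => (hAs q (hmem q hq)).continuousAt.continuousWithinAt)
    (fun q hq => (hBs q (hmem q hq)).continuousAt.continuousWithinAt)
    (fun q hq => ((hAs q (hmem' q hq.1)).differentiableAt one_ne_zero).hasFDerivAt)
    (fun q hq => ((hBs q (hmem' q hq.1)).differentiableAt one_ne_zero).hasFDerivAt) hint
  have hD : MeasurableSet {p : ℝ × ℝ | p.1 ^ 2 + p.2 ^ 2 < R ^ 2} :=
    measurableSet_lt (by fun_prop) (by fun_prop)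
  have hae : (Set.Ioo (0 : ℝ) R ×ˢ Set.Ioo (-π) π : Set (ℝ × ℝ))
      =ᵐ[volume] Set.Icc ((0, -π) : ℝ × ℝ) (R, π) := by
    rw [← Set.Icc_prod_Icc]
    exact Measure.set_prod_ae_eq Ioo_ae_eq_Icc Ioo_ae_eq_Icc
  rw [← integral_indicator hD, ← integral_comp_polarCoord_symm]
  have hstep : ∫ q in polarCoord.target, q.1 •
        ({p : ℝ × ℝ | p.1 ^ 2 + p.2 ^ 2 < R ^ 2}.indicator
          (fun p => fderiv ℝ P p (1, 0) + fderiv ℝ Q p (0, 1)) (polarCoord.symm q))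
      = ∫ q in Set.Icc ((0, -π) : ℝ × ℝ) (R, π), fderiv ℝ A q (1, 0) + fderiv ℝ B q (0, 1) := by
    rw [← setIntegral_congr_set hae,
      show polarCoord.target = Set.Ioi (0 : ℝ) ×ˢ Set.Ioo (-π) π from rfl,
      ← integral_indicator (measurableSet_Ioi.prod measurableSet_Ioo),
      ← integral_indicator (measurableSet_Ioo.prod measurableSet_Ioo)]
    congr 1
    ext q
    have hsymm : polarCoord.symm q = Φ q := rfl
    have hsq : (Φ q).1 ^ 2 + (Φ q).2 ^ 2 = q.1 ^ 2 := by
      simp only [hΦ]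
      linear_combination q.1 ^ 2 * Real.sin_sq_add_cos_sq q.2
    by_cases h1 : q ∈ Set.Ioi (0 : ℝ) ×ˢ Set.Ioo (-π) π
    · have h0 : 0 < q.1 := h1.1
      rw [Set.indicator_of_mem h1, hsymm]
      by_cases h2 : q.1 < R
      · have h3 : Φ q ∈ {p : ℝ × ℝ | p.1 ^ 2 + p.2 ^ 2 < R ^ 2} := by
          rw [Set.mem_ofPred_eq, hsq]
          exact pow_lt_pow_left₀ h2 h0.le two_ne_zero
        have h4 : q ∈ Set.Ioo (0 : ℝ) R ×ˢ Set.Ioo (-π) π := ⟨⟨h0, h2⟩, h1.2⟩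
        rw [Set.indicator_of_mem h3, Set.indicator_of_mem h4,
          key q ⟨h0.le, h2.le⟩]
      · have h3 : Φ q ∉ {p : ℝ × ℝ | p.1 ^ 2 + p.2 ^ 2 < R ^ 2} := by
          rw [Set.mem_ofPred_eq, hsq, not_lt]
          exact pow_le_pow_left₀ hR.le (not_lt.1 h2) 2
        rw [Set.indicator_of_notMem h3, Set.indicator_of_notMem (fun h => h2 h.1.2), smul_zero]
    · rw [Set.indicator_of_notMem h1, Set.indicator_of_notMem (fun h => h1 ⟨h.1.1, h.2⟩)]
  rw [hstep, hdivergence, ← integral_neg_pi_pi_eq (fun θ => by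
    simp only [Real.cos_add_two_pi, Real.sin_add_two_pi])]
  simp only [hA, hB, hΦ, Real.cos_neg, Real.sin_neg, Real.cos_pi, Real.sin_pi]
  simp [mul_comm]


theorem mem_closure_Cyl_iff {R : ℝ} (hR : 0 < R) {x : V3} :
    x ∈ closure (Cyl R) ↔ x 0 ^ 2 + x 1 ^ 2 ≤ R ^ 2 := by
  constructor
  · intro hx
    have hc : IsClosed {x : V3 | x 0 ^ 2 + x 1 ^ 2 ≤ R ^ 2} :=
      isClosed_le (by fun_prop) (by fun_prop)
    have hsub : Cyl R ⊆ {x : V3 | x 0 ^ 2 + x 1 ^ 2 ≤ R ^ 2} := by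
      intro y hy
      have h : y 0 ^ 2 + y 1 ^ 2 < R ^ 2 := hy
      exact h.le
    exact closure_minimal hsub hc hx
  · intro hx
    have hcont : Continuous (fun s : ℝ => (![s * x 0, s * x 1, x 2] : V3)) := by
      refine continuous_pi fun i => ?_
      fin_cases i <;> simp <;> fun_prop
    have h1 : (![1 * x 0, 1 * x 1, x 2] : V3) = x := by
      ext i
      fin_cases i <;> simp
    have hlim : Filter.Tendsto (fun s : ℝ => (![s * x 0, s * x 1, x 2] : V3))
        (nhdsWithin 1 (Set.Ioo 0 1)) (nhds x) := by
      have h := hcont.tendsto 1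
      rw [h1] at h
      exact h.mono_left nhdsWithin_le_nhds
    have hne : (nhdsWithin (1 : ℝ) (Set.Ioo 0 1)).NeBot :=
      right_nhdsWithin_Ioo_neBot one_pos
    refine mem_closure_of_tendsto hlim ?_
    filter_upwards [self_mem_nhdsWithin] with s hs
    have hs2 : s ^ 2 < 1 := by nlinarith [hs.1, hs.2]
    change (s * x 0) ^ 2 + (s * x 1) ^ 2 < R ^ 2
    nlinarith [sq_nonneg s, pow_pos hR 2]

theorem isOpen_Cyl (R : ℝ) : IsOpen (Cyl R) := isOpen_lt (by fun_prop) (by fun_prop)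

theorem measurableSet_Cyl (R : ℝ) : MeasurableSet (Cyl R) := (isOpen_Cyl R).measurableSet

theorem AxialSupp.pd {g : V3 → ℂ} (hg : AxialSupp g) (j : Fin 3) : AxialSupp (pd j g) := by
  obtain ⟨T, hT, h⟩ := hg
  refine ⟨T + 1, by linarith, fun x hx => ?_⟩
  have hopen : IsOpen {y : V3 | T < |y 2|} := isOpen_lt (by fun_prop) (by fun_prop)
  have hx' : x ∈ {y : V3 | T < |y 2|} := by
    change T < |x 2|
    linarith
  have he : g =ᶠ[nhds x] fun _ => 0 := by
    filter_upwards [hopen.mem_nhds hx'] with y hy using h y hy.le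
  simp [_root_.pd, he.fderiv_eq]

theorem AxialSupp.apply {a : V3 → C3} (ha : AxialSupp a) (i : Fin 3) :
    AxialSupp (fun x => a x i) := by
  obtain ⟨T, hT, h⟩ := ha
  exact ⟨T, hT, fun x hx => congrFun (h x hx) i⟩

theorem AxialSupp.add {g h : V3 → ℂ} (hg : AxialSupp g) (hh : AxialSupp h) :
    AxialSupp (fun x => g x + h x) := by
  obtain ⟨T, hT, hg⟩ := hg
  obtain ⟨S, _, hh⟩ := hh
  refine ⟨max T S, lt_max_of_lt_left hT, fun x hx => ?_⟩
  simp only [hg x ((le_max_left _ _).trans hx), hh x ((le_max_right _ _).trans hx), add_zero]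

/-- A function that is continuous up to the boundary of the cylinder and has compact axial support
is integrable. -/
theorem AxialSupp.integrableOn_Cyl {R : ℝ} (hR : 0 < R) {g : V3 → ℂ} (hs : AxialSupp g)
    (hg : ∀ x ∈ closure (Cyl R), ContinuousAt g x) : IntegrableOn g (Cyl R) := by
  obtain ⟨T, hT, hs⟩ := hs
  set K : Set V3 := closure (Cyl R) ∩ {x | |x 2| ≤ T} with hK
  have hKc : IsCompact K := by
    refine (isCompact_Icc (a := fun _ : Fin 3 => -(R + T)) (b := fun _ => R + T)).of_isClosed_subset
      (isClosed_closure.inter (isClosed_le (by fun_prop) (by fun_prop))) ?_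
    rintro x ⟨hx, hxT⟩
    rw [mem_closure_Cyl_iff hR] at hx
    have h0 : |x 0| ≤ R := abs_le_of_sq_le_sq (by nlinarith [sq_nonneg (x 1)]) hR.le
    have h1 : |x 1| ≤ R := abs_le_of_sq_le_sq (by nlinarith [sq_nonneg (x 0)]) hR.le
    have h2 : |x 2| ≤ T := hxT
    rw [abs_le] at h0 h1 h2
    constructor <;> intro i <;> fin_cases i <;> simp <;> linarith
  have hKi : IntegrableOn g K := ContinuousOn.integrableOn_compact hKc
    fun x hx => (hg x hx.1).continuousWithinAt
  refine hKi.of_forall_sdiff_eq_zero (measurableSet_Cyl R) fun x hx => hs x ?_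
  by_contra h
  exact hx.2 ⟨subset_closure hx.1, (not_le.1 h).le⟩

/-- The point of `ℝ³` with axial coordinate `q.1` and transversal coordinates `q.2`. -/
def ofAxial (q : ℝ × ℝ × ℝ) : V3 := ![q.2.1, q.2.2, q.1]

/-- The measurable equivalence splitting off the axial coordinate. -/
def axialEquiv : V3 ≃ᵐ ℝ × ℝ × ℝ :=
  (MeasurableEquiv.piFinSuccAbove (fun _ => ℝ) 2).trans
    ((MeasurableEquiv.refl ℝ).prodCongr MeasurableEquiv.finTwoArrow)

theorem measurePreserving_axialEquiv : MeasurePreserving axialEquiv volume volume :=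
  ((MeasurePreserving.id volume).prod (volume_preserving_finTwoArrow ℝ)).comp
    (volume_preserving_piFinSuccAbove (fun _ => ℝ) 2)

theorem axialEquiv_apply (x : V3) : axialEquiv x = (x 2, x 0, x 1) := rfl

theorem axialEquiv_symm_apply (q : ℝ × ℝ × ℝ) : axialEquiv.symm q = ofAxial q := by
  rw [MeasurableEquiv.symm_apply_eq, axialEquiv_apply]
  rfl

theorem measurePreserving_ofAxial : MeasurePreserving ofAxial volume volume := by
  have h := measurePreserving_axialEquiv.symm
  rwa [show (axialEquiv.symm : ℝ × ℝ × ℝ → V3) = ofAxial from funext axialEquiv_symm_apply] at h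

theorem measurableEmbedding_ofAxial : MeasurableEmbedding ofAxial := by
  have h := axialEquiv.symm.measurableEmbedding
  rwa [show (axialEquiv.symm : ℝ × ℝ × ℝ → V3) = ofAxial from funext axialEquiv_symm_apply] at h

theorem ofAxial_preimage_Cyl (R : ℝ) :
    ofAxial ⁻¹' Cyl R = Set.univ ×ˢ {p : ℝ × ℝ | p.1 ^ 2 + p.2 ^ 2 < R ^ 2} := by
  ext q
  simp [ofAxial, Cyl]

theorem setIntegral_Cyl_eq (R : ℝ) (g : V3 → ℂ) :
    ∫ x in Cyl R, g x = ∫ q in Set.univ ×ˢ {p : ℝ × ℝ | p.1 ^ 2 + p.2 ^ 2 < R ^ 2},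
      g (ofAxial q) := by
  rw [← ofAxial_preimage_Cyl]
  exact (measurePreserving_ofAxial.setIntegral_preimage_emb measurableEmbedding_ofAxial g _).symm

theorem integrableOn_ofAxial {R : ℝ} {g : V3 → ℂ} (hg : IntegrableOn g (Cyl R)) :
    IntegrableOn (fun q => g (ofAxial q))
      (Set.univ ×ˢ {p : ℝ × ℝ | p.1 ^ 2 + p.2 ^ 2 < R ^ 2}) := by
  rw [← ofAxial_preimage_Cyl]
  exact (measurePreserving_ofAxial.integrableOn_comp_preimage measurableEmbedding_ofAxial).2 hg

theorem hasDerivAt_comp_pd {g : V3 → ℂ} {γ : ℝ → V3} {s : ℝ} {j : Fin 3}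
    (hg : DifferentiableAt ℝ g (γ s)) (hγ : HasDerivAt γ (Pi.single j 1) s) :
    HasDerivAt (fun t => g (γ t)) (pd j g (γ s)) s :=
  hg.hasFDerivAt.comp_hasDerivAt s hγ

theorem contDiff_ofAxial : ContDiff ℝ 1 ofAxial := by
  refine contDiff_pi.2 fun i => ?_
  fin_cases i <;> simp [ofAxial] <;> fun_prop

theorem hasDerivAt_ofAxial_fst (q : ℝ × ℝ × ℝ) :
    HasDerivAt (fun t => ofAxial (t, q.2)) (Pi.single 2 1) q.1 := by
  refine hasDerivAt_pi.2 fun i => ?_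
  fin_cases i <;> simp [ofAxial, hasDerivAt_const, hasDerivAt_id']

theorem hasDerivAt_ofAxial_snd_fst (t a b : ℝ) :
    HasDerivAt (fun s => ofAxial (t, s, b)) (Pi.single 0 1) a := by
  refine hasDerivAt_pi.2 fun i => ?_
  fin_cases i <;> simp [ofAxial, hasDerivAt_const, hasDerivAt_id']

theorem hasDerivAt_ofAxial_snd_snd (t a b : ℝ) :
    HasDerivAt (fun s => ofAxial (t, a, s)) (Pi.single 1 1) b := by
  refine hasDerivAt_pi.2 fun i => ?_
  fin_cases i <;> simp [ofAxial, hasDerivAt_const, hasDerivAt_id']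

theorem ofAxial_mem_closure_Cyl {R : ℝ} (hR : 0 < R) {t : ℝ} {p : ℝ × ℝ}
    (hp : p.1 ^ 2 + p.2 ^ 2 ≤ R ^ 2) : ofAxial (t, p) ∈ closure (Cyl R) :=
  (mem_closure_Cyl_iff hR).2 hp

theorem continuousAt_pd {g : V3 → ℂ} {x : V3} (hg : ContDiffAt ℝ 1 g x) (j : Fin 3) :
    ContinuousAt (pd j g) x :=
  (hg.continuousAt_fderiv one_ne_zero).clm_apply continuousAt_const

theorem integral_Cyl_pd_two {R : ℝ} (hR : 0 < R) {g : V3 → ℂ}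
    (hg : ∀ x ∈ closure (Cyl R), ContDiffAt ℝ 1 g x) (hs : AxialSupp g) :
    ∫ x in Cyl R, pd 2 g x = 0 := by
  have hint := integrableOn_ofAxial
    ((hs.pd 2).integrableOn_Cyl hR fun x hx => continuousAt_pd (hg x hx) 2)
  rw [setIntegral_Cyl_eq]
  rw [IntegrableOn, Measure.volume_eq_prod, ← Measure.prod_restrict] at hint
  rw [Measure.volume_eq_prod, ← Measure.prod_restrict, integral_prod_symm _ hint,
    Measure.restrict_univ]
  refine setIntegral_eq_zero_of_forall_eq_zero fun p hp => ?_
  have hp' : p.1 ^ 2 + p.2 ^ 2 ≤ R ^ 2 := le_of_lt hp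
  have hc : ∀ t : ℝ, ContDiffAt ℝ 1 g (ofAxial (t, p)) :=
    fun t => hg _ (ofAxial_mem_closure_Cyl hR hp')
  have hder : ∀ t, HasDerivAt (fun t => g (ofAxial (t, p))) (pd 2 g (ofAxial (t, p))) t :=
    fun t => hasDerivAt_comp_pd (γ := fun t => ofAxial (t, p))
      ((hc t).differentiableAt one_ne_zero) (hasDerivAt_ofAxial_fst (t, p))
  have hcomp : ∀ h : V3 → ℂ, AxialSupp h → HasCompactSupport (fun t : ℝ => h (ofAxial (t, p))) := by
    rintro h ⟨T, _, hT⟩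
    refine HasCompactSupport.intro (isCompact_Icc (a := -T) (b := T)) fun t ht => hT _ ?_
    by_contra hlt
    exact ht (abs_le.1 (not_le.1 hlt).le)
  have hline : Continuous (fun t : ℝ => ofAxial (t, p)) :=
    contDiff_ofAxial.continuous.comp (by fun_prop)
  refine integral_eq_zero_of_hasDerivAt_of_integrable hder ?_ ?_
  · refine Continuous.integrable_of_hasCompactSupport ?_ (hcomp _ (hs.pd 2))
    exact continuous_iff_continuousAt.2 fun t =>
      (continuousAt_pd (hc t) 2).comp (f := fun t : ℝ => ofAxial (t, p)) hline.continuousAt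
  · exact Continuous.integrable_of_hasCompactSupport
      (continuous_iff_continuousAt.2 fun t => (hder t).continuousAt) (hcomp _ hs)

theorem integral_Cyl_pd_zero_add_pd_one {R : ℝ} (hR : 0 < R) {g h : V3 → ℂ}
    (hg : ∀ x ∈ closure (Cyl R), ContDiffAt ℝ 1 g x)
    (hh : ∀ x ∈ closure (Cyl R), ContDiffAt ℝ 1 h x) (hgs : AxialSupp g) (hhs : AxialSupp h) :
    ∫ x in Cyl R, (pd 0 g x + pd 1 h x)
      = surfInt R (fun x => g x * (nuR R x 0 : ℂ) + h x * (nuR R x 1 : ℂ)) := by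
  have hint := integrableOn_ofAxial
    (((hgs.pd 0).add (hhs.pd 1)).integrableOn_Cyl hR fun x hx =>
      (continuousAt_pd (hg x hx) 0).add (continuousAt_pd (hh x hx) 1))
  have hD : MeasurableSet {p : ℝ × ℝ | p.1 ^ 2 + p.2 ^ 2 < R ^ 2} :=
    measurableSet_lt (by fun_prop) (by fun_prop)
  rw [setIntegral_Cyl_eq, Measure.volume_eq_prod, setIntegral_prod _ hint, Measure.restrict_univ,
    surfInt]
  congr 1
  ext t
  have hslice : ContDiff ℝ 1 (fun p : ℝ × ℝ => ofAxial (t, p)) :=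
    contDiff_ofAxial.comp (by fun_prop)
  have hP : ∀ k : V3 → ℂ, (∀ x ∈ closure (Cyl R), ContDiffAt ℝ 1 k x) →
      ∀ p : ℝ × ℝ, p.1 ^ 2 + p.2 ^ 2 ≤ R ^ 2 →
        ContDiffAt ℝ 1 (fun p => k (ofAxial (t, p))) p := fun k hk p hp =>
    (hk _ (ofAxial_mem_closure_Cyl hR hp)).comp p hslice.contDiffAt
  have hdisk := integral_divergence_disk hR (hP g hg) (hP h hh)
  have hcongr : ∫ p in {p : ℝ × ℝ | p.1 ^ 2 + p.2 ^ 2 < R ^ 2},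
        (pd 0 g (ofAxial (t, p)) + pd 1 h (ofAxial (t, p)))
      = ∫ p in {p : ℝ × ℝ | p.1 ^ 2 + p.2 ^ 2 < R ^ 2},
        (fderiv ℝ (fun p => g (ofAxial (t, p))) p (1, 0)
          + fderiv ℝ (fun p => h (ofAxial (t, p))) p (0, 1)) := by
    refine setIntegral_congr_fun hD fun p hp => ?_
    have hp' : p.1 ^ 2 + p.2 ^ 2 ≤ R ^ 2 := le_of_lt hp
    have hcl := ofAxial_mem_closure_Cyl hR (t := t) hp'
    have dg := (((hP g hg p hp').differentiableAt one_ne_zero).hasFDerivAt).comp_hasDerivAt p.1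
      ((hasDerivAt_id p.1).prodMk (hasDerivAt_const p.1 p.2))
    have dh := (((hP h hh p hp').differentiableAt one_ne_zero).hasFDerivAt).comp_hasDerivAt p.2
      ((hasDerivAt_const p.2 p.1).prodMk (hasDerivAt_id p.2))
    have eg := (hasDerivAt_comp_pd (γ := fun s => ofAxial (t, s, p.2))
      ((hg _ hcl).differentiableAt one_ne_zero) (hasDerivAt_ofAxial_snd_fst t p.1 p.2)).unique dg
    have eh := (hasDerivAt_comp_pd (γ := fun s => ofAxial (t, p.1, s))
      ((hh _ hcl).differentiableAt one_ne_zero) (hasDerivAt_ofAxial_snd_snd t p.1 p.2)).unique dh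
    exact congrArg₂ (· + ·) eg eh
  refine (hcongr.trans hdisk).trans ?_
  have hR' : (R : ℂ) ≠ 0 := by exact_mod_cast hR.ne'
  congr 1
  ext θ
  simp [ofAxial, nuR, hR']

/-- The divergence theorem on the cylinder for fields of compact axial support. -/
theorem integral_Cyl_vdiv {R : ℝ} (hR : 0 < R) {F : V3 → C3}
    (hF : ∀ i, ∀ x ∈ closure (Cyl R), ContDiffAt ℝ 1 (fun y => F y i) x) (hs : AxialSupp F) :
    ∫ x in Cyl R, vdiv F x = surfInt R (fun x => ncomp R x (F x)) := by
  have hc := fun i j x hx => continuousAt_pd (hF i x hx) j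
  have h01 := (((hs.apply 0).pd 0).add ((hs.apply 1).pd 1)).integrableOn_Cyl hR
    fun x hx => (hc 0 0 x hx).add (hc 1 1 x hx)
  have h2 := ((hs.apply 2).pd 2).integrableOn_Cyl hR (hc 2 2)
  simp only [vdiv, Fin.sum_univ_three]
  rw [integral_add h01 h2, integral_Cyl_pd_two hR (hF 2) (hs.apply 2),
    integral_Cyl_pd_zero_add_pd_one hR (hF 0) (hF 1) (hs.apply 0) (hs.apply 1), add_zero]
  congr 1
  ext x
  simp [ncomp, Fin.sum_univ_three, nuR]

theorem UpTo.contDiffAt {E : Type*} [NormedAddCommGroup E] [NormedSpace ℝ E] {k : ℕ}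
    {S : Set V3} {g : V3 → E} (hg : UpTo k S g) {x : V3} (hx : x ∈ closure S) :
    ContDiffAt ℝ k g x := by
  obtain ⟨U, hU, hSU, h⟩ := hg
  exact h.contDiffAt (hU.mem_nhds (hSU hx))

theorem ContDiffAt.pdR {g : V3 → ℝ} {x : V3} (hg : ContDiffAt ℝ 2 g x) (j : Fin 3) :
    ContDiffAt ℝ 1 (pdR j g) x :=
  (hg.fderiv_right (m := 1) (by norm_num)).clm_apply contDiffAt_const

theorem continuousAt_pdR {g : V3 → ℝ} {x : V3} (hg : ContDiffAt ℝ 1 g x) (j : Fin 3) :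
    ContinuousAt (pdR j g) x :=
  (hg.continuousAt_fderiv one_ne_zero).clm_apply continuousAt_const

theorem ContDiffAt.complex_ofReal {n : WithTop ℕ∞} {g : V3 → ℝ} {x : V3}
    (hg : ContDiffAt ℝ n g x) : ContDiffAt ℝ n (fun y => (g y : ℂ)) x :=
  ofRealCLM.contDiff.contDiffAt.comp x hg

theorem pd_mul {g h : V3 → ℂ} {x : V3} (hg : DifferentiableAt ℝ g x)
    (hh : DifferentiableAt ℝ h x) (j : Fin 3) :
    pd j (fun y => g y * h y) x = pd j g x * h x + g x * pd j h x := by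
  simp only [pd, fderiv_fun_mul hg hh]
  simp
  ring

theorem pd_sub {g h : V3 → ℂ} {x : V3} (hg : DifferentiableAt ℝ g x)
    (hh : DifferentiableAt ℝ h x) (j : Fin 3) :
    pd j (fun y => g y - h y) x = pd j g x - pd j h x := by
  simp [pd, fderiv_fun_sub hg hh]

theorem pd_ofReal {g : V3 → ℝ} {x : V3} (hg : DifferentiableAt ℝ g x) (j : Fin 3) :
    pd j (fun y => (g y : ℂ)) x = pdR j g x := by
  have h := (ofRealCLM.hasFDerivAt.comp x hg.hasFDerivAt).fderiv
  exact congrArg (fun L : V3 →L[ℝ] ℂ => L (Pi.single j 1)) h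

theorem pd_conj {g : V3 → ℂ} {x : V3} (hg : DifferentiableAt ℝ g x) (j : Fin 3) :
    pd j (fun y => (starRingEnd ℂ) (g y)) x = (starRingEnd ℂ) (pd j g x) := by
  have h := (conjCLE.hasFDerivAt.comp x hg.hasFDerivAt).fderiv
  exact congrArg (fun L : V3 →L[ℝ] ℂ => L (Pi.single j 1)) h

theorem pd_ofReal_smul {r : V3 → ℝ} {a : V3 → C3} {x : V3} (hr : DifferentiableAt ℝ r x)
    (ha : ∀ i, DifferentiableAt ℝ (fun y => a y i) x) (j i : Fin 3) :
    pd j (fun y => ((r y : ℂ) • a y) i) x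
      = (pdR j r x : ℂ) * a x i + (r x : ℂ) * pd j (fun y => a y i) x := by
  have h := pd_mul (ofRealCLM.differentiableAt.comp x hr) (ha i) j
  rw [← pd_ofReal hr]
  exact h

theorem pd_cross {a b : V3 → C3} {x : V3} (ha : ∀ i, DifferentiableAt ℝ (fun y => a y i) x)
    (hb : ∀ i, DifferentiableAt ℝ (fun y => b y i) x) (j i : Fin 3) :
    pd j (fun y => cross (a y) (b y) i) x
      = cross (pdV j a x) (b x) i + cross (a x) (pdV j b x) i := by
  have h : ∀ k l, pd j (fun y => a y k * b y l - a y l * b y k) x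
      = pdV j a x k * b x l - pdV j a x l * b x k
        + (a x k * pdV j b x l - a x l * pdV j b x k) := by
    intro k l
    rw [pd_sub ((ha k).fun_mul (hb l)) ((ha l).fun_mul (hb k)), pd_mul (ha k) (hb l),
      pd_mul (ha l) (hb k)]
    simp only [pdV]
    ring
  fin_cases i
  exacts [h 1 2, h 2 0, h 0 1]

theorem pdR_comm {g : V3 → ℝ} {x : V3} (hg : ContDiffAt ℝ 2 g x) (j k : Fin 3) :
    pdR j (pdR k g) x = pdR k (pdR j g) x := by
  have hd : DifferentiableAt ℝ (fderiv ℝ g) x :=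
    (hg.fderiv_right (m := 1) (by norm_num)).differentiableAt one_ne_zero
  have h : ∀ j k : Fin 3, pdR j (pdR k g) x
      = fderiv ℝ (fderiv ℝ g) x (Pi.single j 1) (Pi.single k 1) := by
    intro j k
    change fderiv ℝ (fun y => fderiv ℝ g y (Pi.single k 1)) x (Pi.single j 1) = _
    rw [fderiv_clm_apply hd (differentiableAt_const _)]
    simp
  rw [h, h]
  exact (hg.isSymmSndFDerivAt (by simp)) _ _

theorem contDiffAt_cross {n : WithTop ℕ∞} {a b : V3 → C3} {x : V3}
    (ha : ∀ i, ContDiffAt ℝ n (fun y => a y i) x) (hb : ∀ i, ContDiffAt ℝ n (fun y => b y i) x)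
    (i : Fin 3) : ContDiffAt ℝ n (fun y => cross (a y) (b y) i) x := by
  have h : ∀ k l, ContDiffAt ℝ n (fun y => a y k * b y l - a y l * b y k) x :=
    fun k l => ((ha k).mul (hb l)).sub ((ha l).mul (hb k))
  fin_cases i
  exacts [h 1 2, h 2 0, h 0 1]

theorem continuousAt_hinner {a b : V3 → C3} {x : V3}
    (ha : ∀ i, ContinuousAt (fun y => a y i) x) (hb : ∀ i, ContinuousAt (fun y => b y i) x) :
    ContinuousAt (fun y => hinner (a y) (b y)) x :=
  tendsto_finsetSum _ fun i _ => (ha i).mul (continuous_conj.continuousAt.comp (hb i))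

theorem continuousAt_vcurl {a : V3 → C3} {x : V3}
    (ha : ∀ i, ContDiffAt ℝ 1 (fun y => a y i) x) (i : Fin 3) :
    ContinuousAt (fun y => vcurl a y i) x := by
  have h : ∀ j k l m, ContinuousAt
      (fun y => pd j (fun z => a z k) y - pd l (fun z => a z m) y) x :=
    fun j k l m => (continuousAt_pd (ha k) j).sub (continuousAt_pd (ha m) l)
  fin_cases i
  exacts [h 1 2 2 1, h 2 0 0 2, h 0 1 1 0]

theorem AxialSupp.exists_forall_pd {a : V3 → C3} (ha : AxialSupp a) :
    ∃ T > 0, ∀ x : V3, T ≤ |x 2| → a x = 0 ∧ ∀ j i, _root_.pd j (fun y => a y i) x = 0 := by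
  choose S hS h' using fun (j i : Fin 3) => (ha.apply i).pd j
  obtain ⟨T, hT, h⟩ := ha
  refine ⟨T + ∑ j, ∑ i, S j i, ?_, fun x hx => ?_⟩
  · have : 0 ≤ ∑ j, ∑ i, S j i :=
      Finset.sum_nonneg fun j _ => Finset.sum_nonneg fun i _ => (hS j i).le
    linarith
  · have hnn : ∀ j i, S j i ≤ ∑ j, ∑ i, S j i := fun j i =>
      (Finset.single_le_sum (f := fun i => S j i) (fun i _ => (hS j i).le)
        (Finset.mem_univ i)).trans
      (Finset.single_le_sum (f := fun j => ∑ i, S j i)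
        (fun j _ => Finset.sum_nonneg fun i _ => (hS j i).le) (Finset.mem_univ j))
    have h0 := (hS 0 0).le.trans (hnn 0 0)
    exact ⟨h x (by linarith), fun j i => h' j i x (by linarith [hnn j i])⟩

theorem AxialSupp.vcurl {a : V3 → C3} (ha : AxialSupp a) : AxialSupp (vcurl a) := by
  obtain ⟨T, hT, h⟩ := ha.exists_forall_pd
  refine ⟨T, hT, fun x hx => ?_⟩
  ext i
  fin_cases i <;> simp [_root_.vcurl, (h x hx).2]

theorem AxialSupp.of_eq_zero {E F : Type*} [Zero E] [Zero F] {a : V3 → E} {g : V3 → F}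
    (ha : AxialSupp a) (h : ∀ x, a x = 0 → g x = 0) : AxialSupp g := by
  obtain ⟨T, hT, h'⟩ := ha
  exact ⟨T, hT, fun x hx => h x (h' x hx)⟩

/-- The field `(εμ)⁻¹ f̄ × (∇μ × v)`, whose divergence is the difference of the volume
integrands, where `κ = (εμ)⁻¹`. -/
def fluxField (κ μ : V3 → ℝ) (v f : V3 → C3) (x : V3) : C3 :=
  cross ((κ x : ℂ) • fun i => (starRingEnd ℂ) (f x i)) (cross (gradC μ x) (v x))

theorem contDiffAt_gradC {μ : V3 → ℝ} {x : V3} (hμ : ContDiffAt ℝ 2 μ x) (i : Fin 3) :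
    ContDiffAt ℝ 1 (fun y => gradC μ y i) x :=
  (hμ.pdR i).complex_ofReal

theorem ContDiffAt.complex_conj {n : WithTop ℕ∞} {g : V3 → ℂ} {x : V3}
    (hg : ContDiffAt ℝ n g x) : ContDiffAt ℝ n (fun y => (starRingEnd ℂ) (g y)) x :=
  conjCLE.contDiff.contDiffAt.comp x hg

theorem contDiffAt_fluxField {κ μ : V3 → ℝ} {v f : V3 → C3} {x : V3}
    (hκ : ContDiffAt ℝ 1 κ x) (hμ : ContDiffAt ℝ 2 μ x)
    (hv : ∀ i, ContDiffAt ℝ 1 (fun y => v y i) x) (hf : ∀ i, ContDiffAt ℝ 1 (fun y => f y i) x)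
    (i : Fin 3) : ContDiffAt ℝ 1 (fun y => fluxField κ μ v f y i) x :=
  contDiffAt_cross (a := fun y => (κ y : ℂ) • fun i => (starRingEnd ℂ) (f y i))
    (fun i => hκ.complex_ofReal.mul (hf i).complex_conj)
    (contDiffAt_cross (contDiffAt_gradC hμ) hv) i

theorem hinner_cross_nuC (R : ℝ) (κ μ : V3 → ℝ) (v f : V3 → C3) (x : V3) :
    (κ x : ℂ) * hinner (cross (gradC μ x) (v x)) (cross (f x) (nuC R x))
      = -ncomp R x (fluxField κ μ v f x) := by
  simp [hinner, cross, ncomp, fluxField, nuC, Fin.sum_univ_three]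
  ring

theorem mul_W0 {μ : V3 → ℝ} {x : V3} (hμ : μ x ≠ 0) (j k : Fin 3) :
    μ x * W0 μ x j k = lapR μ x * (if j = k then 1 else 0)
      + (μ x)⁻¹ * (pdR j μ x * pdR k μ x) - pdR j (pdR k μ) x := by
  rw [W0]
  field_simp

theorem vdiv_fluxField {κ μ : V3 → ℝ} {v f : V3 → C3} {x : V3} {e : ℝ}
    (hμ0 : μ x ≠ 0) (he : e = κ x * μ x)
    (hκ : ContDiffAt ℝ 1 κ x) (hμ : ContDiffAt ℝ 2 μ x)
    (hv : ∀ i, ContDiffAt ℝ 1 (fun y => v y i) x) (hf : ∀ i, ContDiffAt ℝ 1 (fun y => f y i) x)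
    (hdiv : vdiv (fun y => (μ y : ℂ) • v y) x = 0) :
    hinner (vcurl (fun y => (μ y : ℂ) • v y) x) (vcurl (fun y => (κ y : ℂ) • f y) x)
        - hinner (vcurl v x) ((μ x : ℂ) • cross (gradC κ x) (f x))
        + (e : ℂ) * hinner (fun j => ∑ k, (W0 μ x j k : ℂ) * v x k) (f x)
        + (κ x : ℂ) * ∑ j, (pdR j μ x : ℂ) * hinner (pdV j v x) (f x)
        - vdiv (fluxField κ μ v f) x
      = (e : ℂ) * hinner (vcurl v x) (vcurl f x) := by
  have hκ' := hκ.differentiableAt one_ne_zero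
  have hμ' := hμ.differentiableAt two_ne_zero
  have hv' := fun i => (hv i).differentiableAt one_ne_zero
  have hf' := fun i => (hf i).differentiableAt one_ne_zero
  have hc' := fun i => (hf i).complex_conj.differentiableAt one_ne_zero
  have hm' := fun i => (contDiffAt_gradC hμ i).differentiableAt one_ne_zero
  have eμv := pd_ofReal_smul hμ' hv'
  have eκf := pd_ofReal_smul hκ' hf'
  have eg : ∀ j, pdV j (fun y => (κ y : ℂ) • fun i => (starRingEnd ℂ) (f y i)) x
      = fun i => (pdR j κ x : ℂ) * (starRingEnd ℂ) (f x i)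
        + (κ x : ℂ) * (starRingEnd ℂ) (pd j (fun y => f y i) x) := fun j => funext fun i =>
    (pd_ofReal_smul (a := fun y i => (starRingEnd ℂ) (f y i)) hκ' hc' j i).trans
      (by rw [pd_conj (hf' i)])
  have em : ∀ j, pdV j (gradC μ) x = fun i => (pdR j (pdR i μ) x : ℂ) := fun j =>
    funext fun i => pd_ofReal ((hμ.pdR i).differentiableAt one_ne_zero) j
  have ea : ∀ j, pdV j (fun y => cross (gradC μ y) (v y)) x
      = cross (fun i => (pdR j (pdR i μ) x : ℂ)) (v x) + cross (gradC μ x) (pdV j v x) :=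
    fun j => funext fun i => (pd_cross hm' hv' j i).trans (by rw [← em]; rfl)
  have eG : ∀ j i, pd j (fun y => fluxField κ μ v f y i) x
      = cross (pdV j (fun y => (κ y : ℂ) • fun i => (starRingEnd ℂ) (f y i)) x)
          (cross (gradC μ x) (v x)) i
        + cross ((κ x : ℂ) • fun i => (starRingEnd ℂ) (f x i))
          (pdV j (fun y => cross (gradC μ y) (v y)) x) i :=
    pd_cross (a := fun y => (κ y : ℂ) • fun i => (starRingEnd ℂ) (f y i))
      (b := fun y => cross (gradC μ y) (v y))
      (fun i => (hκ.complex_ofReal.mul (hf i).complex_conj).differentiableAt one_ne_zero)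
      (fun i => (contDiffAt_cross (contDiffAt_gradC hμ) hv i).differentiableAt one_ne_zero)
  have hW : ∀ j k, (μ x : ℂ) * (W0 μ x j k : ℂ) = ((lapR μ x * (if j = k then 1 else 0)
      + (μ x)⁻¹ * (pdR j μ x * pdR k μ x) - pdR j (pdR k μ) x : ℝ) : ℂ) :=
    fun j k => by rw [← mul_W0 hμ0 j k, ofReal_mul]
  have hW' : (e : ℂ) * hinner (fun j => ∑ k, (W0 μ x j k : ℂ) * v x k) (f x)
      = (κ x : ℂ) * hinner (fun j => ∑ k, ((μ x : ℂ) * (W0 μ x j k : ℂ)) * v x k) (f x) := by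
    rw [he]
    simp only [hinner, Fin.sum_univ_three]
    push_cast
    ring
  have hlap : lapR μ x = pdR 0 (pdR 0 μ) x + pdR 1 (pdR 1 μ) x + pdR 2 (pdR 2 μ) x :=
    Fin.sum_univ_three _
  have hdiv' : pd 0 (fun y => v y 0) x + pd 1 (fun y => v y 1) x + pd 2 (fun y => v y 2) x
      + (μ x : ℂ)⁻¹ * (pdR 0 μ x * v x 0 + pdR 1 μ x * v x 1 + pdR 2 μ x * v x 2) = 0 := by
    have hne : (μ x : ℂ) ≠ 0 := by exact_mod_cast hμ0
    simp only [vdiv, Fin.sum_univ_three, eμv] at hdiv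
    field_simp
    linear_combination hdiv
  rw [hW', he]
  simp only [hW, hlap]
  simp only [vdiv, eG, Fin.sum_univ_three, hinner, vcurl, Matrix.cons_val_zero,
    Matrix.cons_val_one, Matrix.cons_val, eμv, eκf]
  simp only [eg, ea]
  simp only [cross, gradC, Matrix.cons_val_zero, Matrix.cons_val_one, Matrix.cons_val,
    Pi.smul_apply, Pi.add_apply, smul_eq_mul, pdR_comm hμ 1 0, pdR_comm hμ 2 0, pdR_comm hμ 2 1,
    map_add, map_sub, map_mul, conj_ofReal, pdV]
  push_cast
  linear_combination ((κ x : ℂ) * (pdR 0 μ x * (starRingEnd ℂ) (f x 0)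
    + pdR 1 μ x * (starRingEnd ℂ) (f x 1) + pdR 2 μ x * (starRingEnd ℂ) (f x 2))) * hdiv'

theorem AxialSupp.fluxField {κ μ : V3 → ℝ} {v f : V3 → C3} (hv : AxialSupp v) :
    AxialSupp (fluxField κ μ v f) :=
  hv.of_eq_zero fun x hx => by
    ext i
    fin_cases i <;> simp [_root_.fluxField, cross, hx]

theorem continuousAt_W0 {μ : V3 → ℝ} {x : V3} (hμ0 : μ x ≠ 0) (hμ : ContDiffAt ℝ 2 μ x)
    (j k : Fin 3) : ContinuousAt (fun y => W0 μ y j k) x := by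
  have h0 := hμ.continuousAt
  have h1 := fun i => (hμ.pdR i).continuousAt
  have h2 := fun i l => continuousAt_pdR (hμ.pdR i) l
  have hlap : ContinuousAt (lapR μ) x := tendsto_finsetSum _ fun i _ => h2 i i
  exact ((((h0.inv₀ hμ0).mul hlap).mul continuousAt_const).add
    ((((h0.pow 2).inv₀ (pow_ne_zero 2 hμ0)).mul (h1 j)).mul (h1 k))).sub
      ((h0.inv₀ hμ0).mul (h2 k j))

theorem continuousAt_complex_ofReal {g : V3 → ℝ} {x : V3} (hg : ContinuousAt g x) :
    ContinuousAt (fun y => (g y : ℂ)) x :=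
  continuous_ofReal.continuousAt.comp hg

theorem hinner_zero_left (b : C3) : hinner 0 b = 0 := by simp [hinner]

/-- the identity of Theorem 3.1 (integration by parts for
∫ ε⁻¹⟨curl v, curl f⟩ when div(μv) = 0). -/
theorem statement10 (R : ℝ) (hR : 0 < R) (ε μ : V3 → ℝ) (v f : V3 → C3)
    (hε : UpTo 2 (Cyl R) ε) (hμ : UpTo 2 (Cyl R) μ)
    (hεpos : ∀ x ∈ closure (Cyl R), 0 < ε x) (hμpos : ∀ x ∈ closure (Cyl R), 0 < μ x)
    (hv : UpTo 1 (Cyl R) v) (hf : UpTo 1 (Cyl R) f) (hvs : AxialSupp v)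
    (hdiv : ∀ x ∈ Cyl R, vdiv (fun y => (μ y : ℂ) • v y) x = 0) :
    ∫ x in Cyl R, (((ε x)⁻¹ : ℝ) : ℂ) * hinner (vcurl v x) (vcurl f x)
      = (∫ x in Cyl R, hinner (vcurl (fun y => (μ y : ℂ) • v y) x)
            (vcurl (fun y => (((ε y * μ y)⁻¹ : ℝ) : ℂ) • f y) x))
        - (∫ x in Cyl R, hinner (vcurl v x)
            ((μ x : ℂ) • cross (gradC (fun y => (ε y * μ y)⁻¹) x) (f x)))
        + (∫ x in Cyl R, (((ε x)⁻¹ : ℝ) : ℂ)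
            * hinner (fun j => ∑ k, (W0 μ x j k : ℂ) * v x k) (f x))
        + (∫ x in Cyl R, (((ε x * μ x)⁻¹ : ℝ) : ℂ)
            * ∑ j, (pdR j μ x : ℂ) * hinner (pdV j v x) (f x))
        + surfInt R (fun x => (((ε x * μ x)⁻¹ : ℝ) : ℂ)
            * hinner (cross (gradC μ x) (v x)) (cross (f x) (nuC R x))) := by
  set κ : V3 → ℝ := fun y => (ε y * μ y)⁻¹ with hκdef
  have cμ : ∀ x ∈ closure (Cyl R), ContDiffAt ℝ 2 μ x := fun x hx => hμ.contDiffAt hx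
  have cε : ∀ x ∈ closure (Cyl R), ContDiffAt ℝ 2 ε x := fun x hx => hε.contDiffAt hx
  have cκ : ∀ x ∈ closure (Cyl R), ContDiffAt ℝ 1 κ x := fun x hx =>
    (((cε x hx).mul (cμ x hx)).inv (mul_pos (hεpos x hx) (hμpos x hx)).ne').of_le one_le_two
  have cv : ∀ x ∈ closure (Cyl R), ∀ i, ContDiffAt ℝ 1 (fun y => v y i) x := fun x hx i =>
    contDiffAt_pi.1 (hv.contDiffAt hx) i
  have cf : ∀ x ∈ closure (Cyl R), ∀ i, ContDiffAt ℝ 1 (fun y => f y i) x := fun x hx i =>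
    contDiffAt_pi.1 (hf.contDiffAt hx) i
  have cμ1 := fun x hx => (cμ x hx).of_le one_le_two
  have cμv : ∀ x ∈ closure (Cyl R), ∀ i, ContDiffAt ℝ 1 (fun y => ((μ y : ℂ) • v y) i) x :=
    fun x hx i => (cμ1 x hx).complex_ofReal.mul (cv x hx i)
  have cκf : ∀ x ∈ closure (Cyl R), ∀ i, ContDiffAt ℝ 1 (fun y => ((κ y : ℂ) • f y) i) x :=
    fun x hx i => (cκ x hx).complex_ofReal.mul (cf x hx i)
  have cεinv : ∀ x ∈ closure (Cyl R), ContinuousAt (fun y => (((ε y)⁻¹ : ℝ) : ℂ)) x :=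
    fun x hx => continuousAt_complex_ofReal ((cε x hx).continuousAt.inv₀ (hεpos x hx).ne')
  have sμv : AxialSupp (fun y => (μ y : ℂ) • v y) := hvs.of_eq_zero fun x hx => by simp [hx]
  have i1 : IntegrableOn (fun x => hinner (vcurl (fun y => (μ y : ℂ) • v y) x)
      (vcurl (fun y => (κ y : ℂ) • f y) x)) (Cyl R) :=
    (sμv.vcurl.of_eq_zero fun x hx => by rw [hx, hinner_zero_left]).integrableOn_Cyl hR fun x hx =>
      continuousAt_hinner (continuousAt_vcurl (cμv x hx)) (continuousAt_vcurl (cκf x hx))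
  have i2 : IntegrableOn (fun x => hinner (vcurl v x)
      ((μ x : ℂ) • cross (gradC κ x) (f x))) (Cyl R) := by
    refine (hvs.vcurl.of_eq_zero fun x hx => by rw [hx, hinner_zero_left]).integrableOn_Cyl hR fun x hx =>
      continuousAt_hinner (continuousAt_vcurl (cv x hx)) fun i => ?_
    refine (cμ1 x hx).complex_ofReal.continuousAt.mul ?_
    have h : ∀ k l, ContinuousAt (fun y => gradC κ y k * f y l - gradC κ y l * f y k) x :=
      fun k l => ((continuousAt_complex_ofReal (continuousAt_pdR (cκ x hx) k)).mul
        (cf x hx l).continuousAt).sub ((continuousAt_complex_ofReal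
          (continuousAt_pdR (cκ x hx) l)).mul (cf x hx k).continuousAt)
    fin_cases i
    exacts [h 1 2, h 2 0, h 0 1]
  have i3 : IntegrableOn (fun x => (((ε x)⁻¹ : ℝ) : ℂ)
      * hinner (fun j => ∑ k, (W0 μ x j k : ℂ) * v x k) (f x)) (Cyl R) :=
    (hvs.of_eq_zero fun x hx => by simp [hinner, hx]).integrableOn_Cyl hR fun x hx =>
      (cεinv x hx).mul (continuousAt_hinner (fun i => tendsto_finsetSum _ fun k _ =>
        (continuousAt_complex_ofReal (continuousAt_W0 (hμpos x hx).ne' (cμ x hx) i k)).mul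
          (cv x hx k).continuousAt) fun i => (cf x hx i).continuousAt)
  have i4 : IntegrableOn (fun x => (κ x : ℂ)
      * ∑ j, (pdR j μ x : ℂ) * hinner (pdV j v x) (f x)) (Cyl R) := by
    have hs : AxialSupp (fun x => (κ x : ℂ)
        * ∑ j, (pdR j μ x : ℂ) * hinner (pdV j v x) (f x)) := by
      obtain ⟨T, hT, h⟩ := hvs.exists_forall_pd
      exact ⟨T, hT, fun x hx => by simp [hinner, pdV, (h x hx).2]⟩
    exact hs.integrableOn_Cyl hR fun x hx => (cκ x hx).complex_ofReal.continuousAt.mul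
      (tendsto_finsetSum _ fun j _ =>
        (continuousAt_complex_ofReal (continuousAt_pdR (cμ1 x hx) j)).mul
          (continuousAt_hinner (fun i => continuousAt_pd (cv x hx i) j)
            fun i => (cf x hx i).continuousAt))
  have cF := fun i x hx => contDiffAt_fluxField (cκ x hx) (cμ x hx) (cv x hx) (cf x hx) i
  have sF : AxialSupp (fluxField κ μ v f) := hvs.fluxField
  have i5 : IntegrableOn (vdiv (fluxField κ μ v f)) (Cyl R) := by
    have hs : AxialSupp (vdiv (fluxField κ μ v f)) := by
      obtain ⟨T, hT, h⟩ := sF.exists_forall_pd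
      exact ⟨T, hT, fun x hx => by simp [vdiv, (h x hx).2]⟩
    exact hs.integrableOn_Cyl hR fun x hx =>
      tendsto_finsetSum _ fun j _ => continuousAt_pd (cF j x hx) j
  have hsurf : surfInt R (fun x => (κ x : ℂ)
        * hinner (cross (gradC μ x) (v x)) (cross (f x) (nuC R x)))
      = -∫ x in Cyl R, vdiv (fluxField κ μ v f) x := by
    rw [integral_Cyl_vdiv hR cF sF]
    simp only [hinner_cross_nuC, surfInt, neg_mul, intervalIntegral.integral_neg, integral_neg]
  rw [hsurf, ← sub_eq_add_neg, ← integral_sub i1 i2, ← integral_add (i1.fun_sub i2) i3,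
    ← integral_add ((i1.fun_sub i2).fun_add i3) i4,
    ← integral_sub (((i1.fun_sub i2).fun_add i3).fun_add i4) i5]
  refine setIntegral_congr_fun (measurableSet_Cyl R) fun x hx => ?_
  have hx' := subset_closure hx
  have hμ0 := (hμpos x hx').ne'
  have he : (ε x)⁻¹ = κ x * μ x := by
    have := (hεpos x hx').ne'
    simp only [hκdef]
    field_simp
  exact (vdiv_fluxField hμ0 he (cκ x hx') (cμ x hx') (cv x hx') (cf x hx') (hdiv x hx)).symm

end
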